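/- In the classical (untwisted) shuffle algebra over a field of characteristic zero, setting X_a = v_{p₁}^{·n₁} ⋯ v_{p_s}^{·n_s} for the Lyndon factorization a = p₁^{n₁}⋯p_s^{n_s}, the leading coefficient of v_a in X_a is n₁!⋯n_s! ≠ 0; consequently the X_a, a ∈ S, form a linear basis of ⊕_{n≥1} V^{⊗n}. -/

import Mathlib

open scoped Classical

/-- Lexicographic strict order on words, with the convention that a word is
strictly greater than each of its proper prefixes (i.e. `a ++ b < a`). -/
def wlt {X : Type*} [LinearOrder X] : List X → List X → Prop
  | [], _ => False
  | _ :: _, [] => True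
  | x :: xs, y :: ys => x < y ∨ (x = y ∧ wlt xs ys)

/-- A nonempty word `p` is a Lyndon word if every proper nonempty suffix of `p`
is strictly less than `p`. -/
def IsLyndon {X : Type*} [LinearOrder X] (p : List X) : Prop :=
  p ≠ [] ∧ ∀ u v : List X, u ≠ [] → v ≠ [] → p = u ++ v → wlt v p

/-- `w` is a `(p, n-p)`-shuffle. -/
def IsPQShuffle (p : ℕ) {n : ℕ} (w : Equiv.Perm (Fin n)) : Prop :=
  ∀ i j : Fin n, (i : ℕ) < (j : ℕ) → (((j : ℕ) < p) ∨ (p ≤ (i : ℕ))) →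
    w i < w j

/-- The classical (untwisted) shuffle product of two basis words: the sum over
all `(p, n-p)`-shuffles of the interleaved words. -/
noncomputable def shMulWord (k : Type*) [Field k] {X : Type*} (a b : List X) :
    (List X) →₀ k :=
  ∑ w : Equiv.Perm (Fin (a.length + b.length)),
    if IsPQShuffle a.length w then
      Finsupp.single
        (List.ofFn fun j : Fin (a.length + b.length) =>
          (a ++ b).get (Fin.cast (by simp) (w.symm j))) (1 : k)
    else 0

/-- The classical shuffle product on `T(V)`, extended bilinearly. -/
noncomputable def shMul {k : Type*} [Field k] {X : Type*}
    (f g : (List X) →₀ k) : (List X) →₀ k :=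
  f.sum fun a ca => g.sum fun b cb => (ca * cb) • shMulWord k a b

/-- `X_a` built from a factor list `fs` of Lyndon words: the iterated shuffle
product `v_{p₁} · v_{p₂} · ⋯`. -/
noncomputable def XOf (k : Type*) [Field k] {X : Type*}
    (fs : List (List X)) : (List X) →₀ k :=
  (fs.map fun p => Finsupp.single p (1 : k)).foldr shMul
    (Finsupp.single [] 1)

section WordOrder

variable {X : Type*} [LinearOrder X]

@[simp] theorem wlt_nil_left (b : List X) : ¬ wlt [] b := by simp [wlt]

@[simp] theorem wlt_cons_nil (x : X) (a : List X) : wlt (x :: a) [] := by simp [wlt]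

@[simp] theorem wlt_cons_cons (x y : X) (a b : List X) :
    wlt (x :: a) (y :: b) ↔ x < y ∨ (x = y ∧ wlt a b) := by simp [wlt]

theorem wlt_irrefl (a : List X) : ¬ wlt a a := by
  induction a with
  | nil => simp
  | cons x a ih => simpa using ih

theorem wlt_trans {a b c : List X} (hab : wlt a b) (hbc : wlt b c) : wlt a c := by
  induction a generalizing b c with
  | nil => simp at hab
  | cons x a ih =>
    cases b with
    | nil => simp at hbc
    | cons y b =>
      cases c with
      | nil => simp
      | cons z c =>
        simp only [wlt_cons_cons] at *
        rcases hab with h | ⟨rfl, h⟩ <;> rcases hbc with h' | ⟨rfl, h'⟩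
        · exact .inl (h.trans h')
        · exact .inl h
        · exact .inl h'
        · exact .inr ⟨rfl, ih h h'⟩

theorem wlt_trichotomy (a b : List X) : wlt a b ∨ a = b ∨ wlt b a := by
  induction a generalizing b with
  | nil => cases b <;> simp
  | cons x a ih =>
    cases b with
    | nil => simp
    | cons y b =>
      rcases lt_trichotomy x y with h | rfl | h
      · simp [h]
      · simpa using ih b
      · simp [h]

/-- The reflexive closure of `wlt`. -/
def wle (a b : List X) : Prop := a = b ∨ wlt a b

theorem wle_refl (a : List X) : wle a a := .inl rfl

theorem wle_of_wlt {a b : List X} (h : wlt a b) : wle a b := .inr h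

theorem wle.trans_wlt {a b c : List X} (hab : wle a b) (hbc : wlt b c) : wlt a c := by
  rcases hab with rfl | hab
  · exact hbc
  · exact wlt_trans hab hbc

theorem wlt.trans_wle {a b c : List X} (hab : wlt a b) (hbc : wle b c) : wlt a c := by
  rcases hbc with rfl | hbc
  · exact hab
  · exact wlt_trans hab hbc

theorem wle.trans {a b c : List X} (hab : wle a b) (hbc : wle b c) : wle a c := by
  rcases hab with rfl | hab
  · exact hbc
  · exact wle_of_wlt (hab.trans_wle hbc)

@[simp] theorem wle_cons_cons_self (x : X) (a b : List X) :
    wle (x :: a) (x :: b) ↔ wle a b := by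
  simp [wle]

@[simp] theorem wlt_append_left_iff (c a b : List X) : wlt (c ++ a) (c ++ b) ↔ wlt a b := by
  induction c with
  | nil => simp
  | cons x c ih => simpa using ih

theorem wle.append_left {a b : List X} (h : wle a b) (c : List X) :
    wle (c ++ a) (c ++ b) := by
  rcases h with rfl | h
  · exact wle_refl _
  · exact .inr ((wlt_append_left_iff c a b).2 h)

/-- A word is at most each of its prefixes. -/
theorem wle_append_self (a b : List X) : wle (a ++ b) a := by
  induction a with
  | nil => cases b <;> simp [wle]
  | cons x a ih => simpa using ih

/-- A strict inequality between words of the same length is decided at a letter, so it is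
insensitive to what follows. -/
theorem wlt.append_of_length_eq {a b : List X} (h : wlt a b) (hl : a.length = b.length)
    (c d : List X) : wlt (a ++ c) (b ++ d) := by
  induction a generalizing b with
  | nil => simp at h
  | cons x a ih =>
    cases b with
    | nil => simp at hl
    | cons y b =>
      simp only [List.cons_append, wlt_cons_cons, List.length_cons, add_left_inj] at *
      exact h.imp_right fun h => ⟨h.1, ih h.2 hl⟩

/-- If `u` is strictly larger than `p` then either `p` is a proper extension of `u`, or every
word starting with `u` is still larger than `p`. -/
theorem wlt.prefix_or_append {p u : List X} (h : wlt p u) :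
    (∃ r, r ≠ [] ∧ p = u ++ r) ∨ ∀ v, wlt p (u ++ v) := by
  induction p generalizing u with
  | nil => simp at h
  | cons x p ih =>
    cases u with
    | nil => exact .inl ⟨x :: p, by simp, by simp⟩
    | cons y u =>
      rw [wlt_cons_cons] at h
      rcases h with h | ⟨rfl, h⟩
      · exact .inr fun v => by simp [h]
      · rcases ih h with ⟨r, hr, rfl⟩ | h'
        · exact .inl ⟨r, hr, rfl⟩
        · exact .inr fun v => by simpa using h' v

theorem IsLyndon.wle_of_suffix {p r : List X} (hp : IsLyndon p) (hr : r ≠ []) (h : r <:+ p) :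
    wle r p := by
  obtain ⟨t, ht⟩ := h
  rcases eq_or_ne t [] with rfl | ht'
  · exact .inl (by simpa using ht)
  · exact .inr (hp.2 t r ht' hr ht.symm)

theorem IsLyndon.wlt_nil {p : List X} (hp : IsLyndon p) : wlt p [] := by
  cases p with
  | nil => exact absurd rfl hp.1
  | cons x p => simp

/-- The words strictly above a Lyndon word are closed under concatenation. -/
theorem IsLyndon.wlt_append {p u v : List X} (hp : IsLyndon p) (hu : wlt p u) (hv : wlt p v) :
    wlt p (u ++ v) := by
  rcases hu.prefix_or_append with ⟨r, hr, rfl⟩ | h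
  · rw [wlt_append_left_iff]
    exact (hp.wle_of_suffix hr (List.suffix_append u r)).trans_wlt hv
  · exact h v

theorem IsLyndon.wlt_flatten {p : List X} (hp : IsLyndon p) (L : List (List X))
    (h : ∀ q ∈ L, wlt p q) : wlt p L.flatten := by
  induction L with
  | nil => exact hp.wlt_nil
  | cons q L ih =>
    exact hp.wlt_append (h q (by simp)) (ih fun q' hq' => h q' (by simp [hq']))

end WordOrder

/-- `Shuf a b w` says that `w` is an interleaving of `a` and `b`. -/
inductive Shuf {X : Type*} : List X → List X → List X → Prop
  | nil : Shuf [] [] []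
  | left {a b w : List X} (x : X) (h : Shuf a b w) : Shuf (x :: a) b (x :: w)
  | right {a b w : List X} (x : X) (h : Shuf a b w) : Shuf a (x :: b) (x :: w)

namespace Shuf

variable {X : Type*}

theorem symm {a b w : List X} (h : Shuf a b w) : Shuf b a w := by
  induction h with
  | nil => exact .nil
  | left x _ ih => exact .right x ih
  | right x _ ih => exact .left x ih

theorem perm {a b w : List X} (h : Shuf a b w) : w.Perm (a ++ b) := by
  induction h with
  | nil => exact .refl _
  | left x _ ih => exact ih.cons x
  | right x _ ih => exact (ih.cons x).trans List.perm_middle.symm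

theorem length_eq {a b w : List X} (h : Shuf a b w) : w.length = a.length + b.length := by
  simpa using h.perm.length_eq

theorem nil_left (b : List X) : Shuf [] b b := by
  induction b with
  | nil => exact .nil
  | cons x b ih => exact .right x ih

theorem append (a b : List X) : Shuf a b (a ++ b) := by
  induction a with
  | nil => exact nil_left b
  | cons x a ih => exact .left x ih

theorem eq_of_nil_left {b w : List X} (h : Shuf [] b w) : w = b := by
  generalize ha : ([] : List X) = a at h
  induction h with
  | nil => rfl
  | left => simp at ha
  | right x _ ih => rw [ih ha]

theorem eq_of_nil_right {a w : List X} (h : Shuf a [] w) : w = a := h.symm.eq_of_nil_left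

theorem split {u v w₁ w₂ : List X} (h : Shuf u v (w₁ ++ w₂)) :
    ∃ u₁ u₂ v₁ v₂, u = u₁ ++ u₂ ∧ v = v₁ ++ v₂ ∧ Shuf u₁ v₁ w₁ ∧ Shuf u₂ v₂ w₂ := by
  induction w₁ generalizing u v with
  | nil => exact ⟨[], u, [], v, rfl, rfl, .nil, h⟩
  | cons x w₁ ih =>
    cases h with
    | left _ h =>
      obtain ⟨u₁, u₂, v₁, v₂, rfl, rfl, h₁, h₂⟩ := ih h
      exact ⟨x :: u₁, u₂, v₁, v₂, rfl, rfl, .left x h₁, h₂⟩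
    | right _ h =>
      obtain ⟨u₁, u₂, v₁, v₂, rfl, rfl, h₁, h₂⟩ := ih h
      exact ⟨u₁, u₂, x :: v₁, v₂, rfl, rfl, .right x h₁, h₂⟩

variable [LinearOrder X]

/-- Enlarging one factor enlarges the corresponding interleaving. -/
theorem exists_wlt {p u u' w : List X} (hu : wlt u' u) (hl : u'.length = u.length)
    (h : Shuf p u w) : ∃ w', Shuf p u' w' ∧ wlt w' w := by
  induction h generalizing u' with
  | nil => simp_all
  | left x _ ih =>
    obtain ⟨w', h', hw⟩ := ih hu hl
    exact ⟨x :: w', .left x h', by simpa using hw⟩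
  | @right a b w x h ih =>
    cases u' with
    | nil => simp at hl
    | cons y u' =>
      rw [wlt_cons_cons] at hu
      rcases hu with hu | ⟨rfl, hu⟩
      · exact ⟨y :: (a ++ u'), .right y (append a u'), by simp [hu]⟩
      · obtain ⟨w', h', hw⟩ := ih hu (by simpa using hl)
        exact ⟨y :: w', .right y h', by simpa using hw⟩

/-- One step of the greedy merge, given the exchange property for shorter words. -/
theorem greedy_of_exchange {c : X} {u v w : List X} (huv : wle (c :: u) v)
    (ex : ∀ v', v = c :: v' → wlt u v' → ∀ w, Shuf ([c] ++ u) v' w →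
      ∃ w', Shuf u ([c] ++ v') w' ∧ wle w' w)
    (h : Shuf (c :: u) v w) : ∃ w', Shuf u v w' ∧ wle (c :: w') w := by
  cases h with
  | left _ h => exact ⟨_, h, wle_refl _⟩
  | @right _ v w d h =>
    rcases huv with heq | hlt
    · obtain ⟨rfl, rfl⟩ := List.cons.inj heq
      exact ⟨w, h.symm, wle_refl _⟩
    · rw [wlt_cons_cons] at hlt
      rcases hlt with hlt | ⟨rfl, hlt⟩
      · exact ⟨_, append u (d :: v), .inr (by simp [hlt])⟩
      · obtain ⟨w', h', hw⟩ := ex v rfl hlt w h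
        exact ⟨w', h', by simpa using hw⟩

/-- Moving a prefix `z` from the larger-continuing word to the other one does not lower the
best interleaving. -/
theorem exchange {z u v w : List X} (huv : wlt u v) (h : Shuf (z ++ u) v w) :
    ∃ w', Shuf u (z ++ v) w' ∧ wle w' w := by
  obtain ⟨n, hn⟩ : ∃ n, z.length + u.length + v.length = n := ⟨_, rfl⟩
  induction n using Nat.strong_induction_on generalizing z u v w with
  | _ n ih =>
    cases z with
    | nil => exact ⟨w, h, wle_refl _⟩
    | cons c z =>
      by_cases hle : wle (c :: z ++ u) v
      · obtain ⟨w₁, h₁, hw₁⟩ := greedy_of_exchange hle (fun v' hv' hlt w hw => by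
          subst hv'
          exact ih _ (by simp at hn ⊢; omega) hlt hw rfl) h
        obtain ⟨w₂, h₂, hw₂⟩ := ih _ (by simp at hn ⊢; omega) huv h₁ rfl
        exact ⟨c :: w₂, .right c h₂, wle.trans (by simpa using hw₂) hw₁⟩
      · have hlt : wlt v (c :: z ++ u) := by
          rcases wlt_trichotomy (c :: z ++ u) v with h' | h' | h'
          · exact absurd (wle_of_wlt h') hle
          · exact absurd (.inl h') hle
          · exact h'
        cases v with
        | nil => simp at hlt
        | cons d v =>
          obtain ⟨w₁, h₁, hw₁⟩ := greedy_of_exchange (wle_of_wlt hlt) (fun v' hv' hlt w hw => by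
            have hl := congrArg List.length hv'
            exact ih _ (by simp at hn hl ⊢; omega) hlt hw rfl) h.symm
          cases u with
          | nil => simp at huv
          | cons e u =>
            rw [wlt_cons_cons] at huv
            rcases huv with huv | ⟨rfl, huv⟩
            · exact ⟨_, append (e :: u) (c :: z ++ d :: v),
                wle.trans (.inr (by simp [huv])) hw₁⟩
            · have h₁' : Shuf ((c :: z ++ [e]) ++ u) v w₁ := by simpa using h₁.symm
              obtain ⟨w₂, h₂, hw₂⟩ := ih _ (by simp at hn ⊢; omega) huv h₁' rfl
              refine ⟨e :: w₂, .left e ?_, wle.trans (by simpa using hw₂) hw₁⟩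
              simpa using h₂

/-- The best interleaving starts with the first letter of the larger word. -/
theorem greedy {c : X} {u v w : List X} (huv : wle (c :: u) v) (h : Shuf (c :: u) v w) :
    ∃ w', Shuf u v w' ∧ wle (c :: w') w :=
  greedy_of_exchange huv (fun _ _ hlt _ hw => exchange hlt hw) h

end Shuf

section LyndonShuffle

variable {X : Type*} [LinearOrder X]

theorem wlt_append_self {a b : List X} (hb : b ≠ []) : wlt (a ++ b) a := by
  rcases wle_append_self a b with h | h
  · simp_all
  · exact h

theorem IsLyndon.wlt_shuf_of_suffix {p r u v w : List X} (hp : IsLyndon p) (hr : r <:+ p)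
    (hu : wlt r u) (hv : wlt p v) (h : Shuf u v w) : wlt r w := by
  obtain ⟨n, hn⟩ : ∃ n, u.length + v.length = n := ⟨_, rfl⟩
  induction n generalizing r u v w with
  | zero =>
    obtain ⟨rfl, rfl⟩ : u = [] ∧ v = [] := by simpa using hn
    rwa [h.eq_of_nil_left]
  | succ n ih =>
    have hr₀ : r ≠ [] := by rintro rfl; simp at hu
    by_cases huv : wle u v
    · cases u with
      | nil =>
        obtain rfl : v = [] := by simpa [wle, eq_comm] using huv
        simp at hn
      | cons c u =>
        obtain ⟨w', h', hw⟩ := Shuf.greedy huv h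
        refine wlt.trans_wle ?_ hw
        cases r with
        | nil => simp at hu
        | cons x r =>
          rw [wlt_cons_cons] at hu ⊢
          exact hu.imp_right fun hu =>
            ⟨hu.1, ih ((List.suffix_cons x r).trans hr) hu.2 hv h' (by simp at hn; omega)⟩
    · have hvu : wlt v u := by
        rcases wlt_trichotomy u v with h' | h' | h'
        · exact absurd (wle_of_wlt h') huv
        · exact absurd (.inl h') huv
        · exact h'
      cases v with
      | nil => simp at hvu
      | cons c v =>
        obtain ⟨w', h', hw⟩ := Shuf.greedy (wle_of_wlt hvu) h.symm
        refine (hp.wle_of_suffix hr₀ hr).trans_wlt (wlt.trans_wle ?_ hw)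
        have hpu := wlt_trans hv hvu
        cases p with
        | nil => simp at hv
        | cons x p =>
          rw [wlt_cons_cons] at hv ⊢
          exact hv.imp_right fun hv =>
            ⟨hv.1, ih (List.suffix_cons x p) hv.2 hpu h' (by simp at hn; omega)⟩

/-- The words strictly above a Lyndon word are closed under interleaving. -/
theorem IsLyndon.wlt_shuf {p u v w : List X} (hp : IsLyndon p) (hu : wlt p u) (hv : wlt p v)
    (h : Shuf u v w) : wlt p w :=
  hp.wlt_shuf_of_suffix List.suffix_rfl hu hv h

theorem IsLyndon.wlt_shuf_of_ne_nil {p t u₁ u₂ v₁ v₂ w : List X} (hp : IsLyndon p)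
    (ht : wlt p t ∨ p <+: t) (hu : p = u₁ ++ u₂) (hv : t = v₁ ++ v₂) (hu₁ : u₁ ≠ [])
    (hv₁ : v₁ ≠ []) (h : Shuf u₁ v₁ w) (hw : w.length = p.length) : wlt p w := by
  have hl := h.length_eq
  have hu₁' := List.length_pos_iff.2 hu₁
  have hv₁' := List.length_pos_iff.2 hv₁
  refine hp.wlt_shuf ?_ ?_ h
  · conv_lhs => rw [hu]
    refine wlt_append_self ?_
    rintro rfl
    simp at hu
    subst hu
    omega
  · rcases ht with ht | ht
    · exact ht.trans_wle (hv ▸ wle_append_self v₁ v₂)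
    · obtain ⟨s, hs⟩ := List.prefix_of_prefix_length_le ⟨v₂, hv.symm⟩ ht (by omega)
      rw [← hs]
      refine wlt_append_self ?_
      rintro rfl
      simp at hs
      subst hs
      omega

theorem wlt_or_prefix_replicate {p b : List X} (hb : wlt p b) (m : ℕ) :
    wlt p ((List.replicate m p).flatten ++ b) ∨ p <+: (List.replicate m p).flatten ++ b := by
  cases m with
  | zero => exact .inl (by simpa using hb)
  | succ m => exact .inr (by simp [List.replicate_succ])

/-- Interleaving a Lyndon word `p` with `p ^ m ++ b`, where `b` is strictly above `p`, gives
only words that are at least `p ^ (m + 1) ++ b`. -/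
theorem IsLyndon.wle_shuf_replicate {p b w : List X} (hp : IsLyndon p) (hb : wlt p b) (m : ℕ)
    (h : Shuf p ((List.replicate m p).flatten ++ b) w) :
    wle (p ++ ((List.replicate m p).flatten ++ b)) w := by
  induction m generalizing w with
  | zero =>
    have ht := wlt_or_prefix_replicate hb 0
    simp only [List.replicate_zero, List.flatten_nil, List.nil_append] at h ht ⊢
    have hl := h.length_eq
    rw [← List.take_append_drop p.length w] at h ⊢
    have hlt : (w.take p.length).length = p.length := by simp [hl]
    obtain ⟨u₁, u₂, v₁, v₂, hu, hv, h₁, h₂⟩ := h.split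
    by_cases hu₁ : u₁ = []
    · subst hu₁
      rw [h₁.eq_of_nil_left] at hlt ⊢
      exact .inr ((hb.trans_wle (hv ▸ wle_append_self v₁ v₂)).append_of_length_eq hlt.symm _ _)
    by_cases hv₁ : v₁ = []
    · subst hv₁
      rw [h₁.eq_of_nil_right] at hlt ⊢
      obtain rfl : u₂ = [] := by
        have := congrArg List.length hu
        simpa [hlt] using this
      rw [h₂.eq_of_nil_left]
      simp_all [wle]
    · exact .inr ((hp.wlt_shuf_of_ne_nil ht hu hv hu₁ hv₁ h₁ hlt).append_of_length_eq hlt.symm _ _)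
  | succ m ih =>
    have ht := wlt_or_prefix_replicate hb (m + 1)
    simp only [List.replicate_succ, List.flatten_cons, List.append_assoc] at h ht ⊢
    have hl := h.length_eq
    rw [← List.take_append_drop p.length w] at h ⊢
    have hlt : (w.take p.length).length = p.length := by simp [hl]
    obtain ⟨u₁, u₂, v₁, v₂, hu, hv, h₁, h₂⟩ := h.split
    by_cases hu₁ : u₁ = []
    · subst hu₁
      rw [h₁.eq_of_nil_left] at hlt ⊢
      obtain ⟨rfl, rfl⟩ := List.append_inj hv hlt.symm
      obtain rfl : p = u₂ := hu
      exact (ih h₂).append_left _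
    by_cases hv₁ : v₁ = []
    · subst hv₁
      rw [h₁.eq_of_nil_right] at hlt ⊢
      obtain rfl : u₂ = [] := by
        have := congrArg List.length hu
        simpa [hlt] using this
      rw [h₂.eq_of_nil_left]
      simp_all [wle]
    · exact .inr ((hp.wlt_shuf_of_ne_nil ht hu hv hu₁ hv₁ h₁ hlt).append_of_length_eq hlt.symm _ _)

end LyndonShuffle

/-- The number of ways to obtain `w` as an interleaving of `a` and `b`. -/
noncomputable def shufCount {X : Type*} : List X → List X → List X → ℕ
  | a, b, [] => if a = [] ∧ b = [] then 1 else 0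
  | a, b, z :: w =>
    (if a.head? = some z then shufCount a.tail b w else 0) +
      (if b.head? = some z then shufCount a b.tail w else 0)

section ShufCount

variable {X : Type*}

theorem shuf_of_shufCount_ne_zero {a b w : List X} (h : shufCount a b w ≠ 0) : Shuf a b w := by
  induction w generalizing a b with
  | nil =>
    obtain ⟨rfl, rfl⟩ : a = [] ∧ b = [] := by
      by_contra hab
      simp [shufCount, hab] at h
    exact .nil
  | cons z w ih =>
    by_cases ha : a.head? = some z ∧ shufCount a.tail b w ≠ 0
    · cases a with
      | nil => simp at ha
      | cons x a =>
        obtain ⟨rfl, ha'⟩ : x = z ∧ shufCount a b w ≠ 0 := by simpa using ha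
        exact .left x (ih ha')
    · by_cases hb : b.head? = some z ∧ shufCount a b.tail w ≠ 0
      · cases b with
        | nil => simp at hb
        | cons x b =>
          obtain ⟨rfl, hb'⟩ : x = z ∧ shufCount a b w ≠ 0 := by simpa using hb
          exact .right x (ih hb')
      · simp only [shufCount] at h
        simp only [not_and, not_not] at ha hb
        refine absurd ?_ h
        split_ifs <;> simp_all

theorem shufCount_nil_left_self (b : List X) : shufCount [] b b = 1 := by
  induction b with
  | nil => simp [shufCount]
  | cons x b ih => simp [shufCount, ih]

theorem shufCount_nil_right_self (a : List X) : shufCount a [] a = 1 := by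
  induction a with
  | nil => simp [shufCount]
  | cons x b ih => simp [shufCount, ih]

theorem shufCount_eq_zero_of_length_ne {a b w : List X} (h : w.length ≠ a.length + b.length) :
    shufCount a b w = 0 := by
  by_contra h'
  exact h (shuf_of_shufCount_ne_zero h').length_eq

/-- Deconcatenation is compatible with counting interleavings. -/
theorem shufCount_append (u v w₁ w₂ : List X) :
    shufCount u v (w₁ ++ w₂) = ∑ ij ∈ Finset.HasAntidiagonal.antidiagonal w₁.length,
      shufCount (u.take ij.1) (v.take ij.2) w₁ * shufCount (u.drop ij.1) (v.drop ij.2) w₂ := by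
  induction w₁ generalizing u v with
  | nil => simp [shufCount]
  | cons z w ih =>
    simp only [List.cons_append, shufCount, add_mul, Finset.sum_add_distrib, List.length_cons]
    congr 1
    · rw [Finset.Nat.sum_antidiagonal_succ]
      cases u with
      | nil => simp
      | cons x u => by_cases hx : x = z <;> simp [ih, hx]
    · rw [Finset.Nat.sum_antidiagonal_succ']
      cases v with
      | nil => simp
      | cons x v => by_cases hx : x = z <;> simp [ih, hx]

theorem shufCount_lyndon_step [LinearOrder X] {p t : List X} (hp : IsLyndon p)
    (ht : wlt p t ∨ p <+: t) :
    shufCount p t (p ++ t) = 1 +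
      shufCount [] (t.take p.length) p * shufCount p (t.drop p.length) t := by
  have hp₀ := List.length_pos_iff.2 hp.1
  rw [shufCount_append, Finset.sum_eq_add_of_mem (p.length, 0) (0, p.length) (by simp) (by simp)
    (by simp; omega)]
  · simp [shufCount_nil_left_self, shufCount_nil_right_self]
  · rintro ⟨i, j⟩ hij hne
    rw [Finset.HasAntidiagonal.mem_antidiagonal] at hij
    simp only [ne_eq, Prod.mk.injEq, not_and] at hij hne
    refine Nat.mul_eq_zero.2 (.inl ?_)
    by_contra h
    have h' := shuf_of_shufCount_ne_zero h
    have hl := h'.length_eq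
    simp only [List.length_take] at hl
    refine wlt_irrefl p (hp.wlt_shuf_of_ne_nil ht (List.take_append_drop i p).symm
      (List.take_append_drop j t).symm ?_ ?_ h' rfl)
    · rw [← List.length_pos_iff, List.length_take]
      omega
    · rw [← List.length_pos_iff, List.length_take]
      omega

theorem IsLyndon.shufCount_replicate [LinearOrder X] {p b : List X} (hp : IsLyndon p)
    (hb : wlt p b) (m : ℕ) :
    shufCount p ((List.replicate m p).flatten ++ b)
      (p ++ ((List.replicate m p).flatten ++ b)) = m + 1 := by
  induction m with
  | zero =>
    rw [shufCount_lyndon_step hp (wlt_or_prefix_replicate hb 0)]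
    simp only [List.replicate_zero, List.flatten_nil, List.nil_append]
    have h : shufCount [] (b.take p.length) p = 0 := by
      by_contra h
      have h' := (shuf_of_shufCount_ne_zero h).eq_of_nil_left
      have h'' := hb.trans_wle (List.take_append_drop p.length b ▸
        wle_append_self (b.take p.length) (b.drop p.length))
      rw [← h'] at h''
      exact wlt_irrefl p h''
    simp [h]
  | succ m ih =>
    rw [shufCount_lyndon_step hp (wlt_or_prefix_replicate hb (m + 1))]
    simp only [List.replicate_succ, List.flatten_cons, List.append_assoc, List.take_left,
      List.drop_left, shufCount_nil_left_self, ih]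
    ring

end ShufCount

section PermCount

/-- The permutation of `Fin (n + 1)` sending `q` to `0` and acting as `τ` on the rest. -/
def permInsert {n : ℕ} (q : Fin (n + 1)) (τ : Equiv.Perm (Fin n)) : Equiv.Perm (Fin (n + 1)) :=
  (finSuccEquiv' q).trans ((Equiv.optionCongr τ).trans (finSuccEquiv' 0).symm)

@[simp] theorem permInsert_self {n : ℕ} (q : Fin (n + 1)) (τ : Equiv.Perm (Fin n)) :
    permInsert q τ q = 0 := by
  simp [permInsert]

@[simp] theorem permInsert_succAbove {n : ℕ} (q : Fin (n + 1)) (τ : Equiv.Perm (Fin n))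
    (i : Fin n) : permInsert q τ (q.succAbove i) = (τ i).succ := by
  simp [permInsert]

theorem permInsert_bijective (n : ℕ) :
    Function.Bijective fun x : Fin (n + 1) × Equiv.Perm (Fin n) => permInsert x.1 x.2 := by
  rw [Fintype.bijective_iff_injective_and_card]
  constructor
  · rintro ⟨q, τ⟩ ⟨q', τ'⟩ h
    dsimp only at h
    obtain rfl : q = q' := by
      apply (permInsert q' τ').injective
      rw [permInsert_self, ← h, permInsert_self]
    congr 1
    ext i : 1
    have := congrArg (fun σ : Equiv.Perm (Fin (n + 1)) => σ (q.succAbove i)) h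
    simpa using this
  · simp [Fintype.card_perm, Nat.factorial_succ]

theorem isPQShuffle_permInsert_zero {p n : ℕ} (τ : Equiv.Perm (Fin n)) :
    IsPQShuffle (p + 1) (permInsert 0 τ) ↔ IsPQShuffle p τ := by
  constructor
  · intro h i j hij hp
    have := h ((0 : Fin (n + 1)).succAbove i) ((0 : Fin (n + 1)).succAbove j) (by simpa using hij)
      (by simpa using hp)
    simpa only [permInsert_succAbove, Fin.succ_lt_succ_iff] using this
  · intro h i j hij hp
    rcases Fin.eq_self_or_eq_succAbove 0 i with rfl | ⟨i, rfl⟩ <;>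
    rcases Fin.eq_self_or_eq_succAbove 0 j with rfl | ⟨j, rfl⟩
    · simp at hij
    · simp only [permInsert_self, permInsert_succAbove, Fin.succ_pos]
    · simp at hij
    · simp only [permInsert_succAbove, Fin.succ_lt_succ_iff]
      exact h i j (by simpa using hij) (by simpa using hp)

theorem isPQShuffle_permInsert_self {p n : ℕ} (q : Fin (n + 1)) (hq : (q : ℕ) = p)
    (τ : Equiv.Perm (Fin n)) : IsPQShuffle p (permInsert q τ) ↔ IsPQShuffle p τ := by
  have hval (i : Fin n) : (q.succAbove i : ℕ) = if (i : ℕ) < p then (i : ℕ) else i + 1 := by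
    simp only [Fin.succAbove, Fin.lt_def, Fin.val_castSucc, hq]
    split_ifs <;> simp
  constructor
  · intro h i j hij hp
    have := h (q.succAbove i) (q.succAbove j) (by rw [hval, hval]; split_ifs <;> omega)
      (by rw [hval, hval]; split_ifs <;> omega)
    simpa only [permInsert_succAbove, Fin.succ_lt_succ_iff] using this
  · intro h i j hij hp
    rcases Fin.eq_self_or_eq_succAbove q i with hi | ⟨i, rfl⟩ <;>
    rcases Fin.eq_self_or_eq_succAbove q j with hj | ⟨j, rfl⟩
    · simp [hi, hj] at hij
    · simp only [hi, permInsert_self, permInsert_succAbove, Fin.succ_pos]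
    · rw [hj, hval] at hij
      rw [hj, hval] at hp
      split_ifs at hij hp <;> omega
    · simp only [permInsert_succAbove, Fin.succ_lt_succ_iff]
      rw [hval, hval] at hij
      rw [hval, hval] at hp
      exact h i j (by split_ifs at hij <;> omega) (by split_ifs at hp <;> omega)

theorem eq_of_isPQShuffle_permInsert {p n : ℕ} {q : Fin (n + 1)} {τ : Equiv.Perm (Fin n)}
    (h : IsPQShuffle p (permInsert q τ)) : (q : ℕ) = 0 ∨ (q : ℕ) = p := by
  by_contra! hq
  rcases Nat.lt_or_ge q p with hqp | hqp
  · have := h 0 q (by rw [Fin.val_zero]; omega) (.inl hqp)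
    simp at this
  · have := h ⟨p, by omega⟩ q (by dsimp only; omega) (.inr le_rfl)
    simp at this

variable {X : Type*}

/-- The number of `(p, n - p)`-shuffles that rearrange the word `l` into the word `w`. -/
noncomputable def permCount (p n : ℕ) (l w : List X) : ℕ :=
  ∑ σ : Equiv.Perm (Fin n),
    if IsPQShuffle p σ ∧ ∀ i : Fin n, l[(i : ℕ)]? = w[(σ i : ℕ)]? then 1 else 0

theorem permCount_succ (p n : ℕ) (l w : List X) (z : X) :
    permCount p (n + 1) l (z :: w) =
      (if 0 < p ∧ l[0]? = some z then permCount (p - 1) n l.tail w else 0) +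
      (if p ≤ n ∧ l[p]? = some z then permCount p n (l.eraseIdx p) w else 0) := by
  have key (q : Fin (n + 1)) (τ : Equiv.Perm (Fin n)) :
      (∀ i : Fin (n + 1), l[(i : ℕ)]? = (z :: w)[(permInsert q τ i : ℕ)]?) ↔
        l[(q : ℕ)]? = some z ∧
          ∀ i : Fin n, (l.eraseIdx q)[(i : ℕ)]? = w[(τ i : ℕ)]? := by
    rw [Fin.forall_iff_succAbove q]
    simp only [permInsert_self, permInsert_succAbove, Fin.val_zero, List.getElem?_cons_zero,
      Fin.val_succ, List.getElem?_cons_succ]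
    refine and_congr_right fun _ => forall_congr' fun i => ?_
    rw [List.getElem?_eraseIdx]
    simp only [Fin.succAbove, Fin.lt_def, Fin.val_castSucc]
    split_ifs <;> simp
  have hsum : permCount p (n + 1) l (z :: w) = ∑ q : Fin (n + 1), ∑ τ : Equiv.Perm (Fin n),
      if IsPQShuffle p (permInsert q τ) ∧ l[(q : ℕ)]? = some z ∧
        ∀ i : Fin n, (l.eraseIdx q)[(i : ℕ)]? = w[(τ i : ℕ)]? then 1 else 0 := by
    rw [permCount, ← Fintype.sum_prod_type',
      ← (Equiv.ofBijective _ (permInsert_bijective n)).sum_comp]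
    refine Finset.sum_congr rfl fun x _ => ?_
    simp only [Equiv.ofBijective_apply, key]
  have hq (q : Fin (n + 1)) : (∑ τ : Equiv.Perm (Fin n),
      if IsPQShuffle p (permInsert q τ) ∧ l[(q : ℕ)]? = some z ∧
        ∀ i : Fin n, (l.eraseIdx q)[(i : ℕ)]? = w[(τ i : ℕ)]? then 1 else 0) =
      (if q = 0 then
        (if 0 < p ∧ l[0]? = some z then permCount (p - 1) n l.tail w else 0) else 0) +
      (if (q : ℕ) = p then
        (if l[p]? = some z then permCount p n (l.eraseIdx p) w else 0) else 0) := by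
    by_cases hqp : (q : ℕ) = p
    · have h0 : (if q = 0 then
        (if 0 < p ∧ l[0]? = some z then permCount (p - 1) n l.tail w else 0) else 0) = 0 := by
        split_ifs with h1 h2
        · subst h1
          simp at hqp
          omega
        · rfl
        · rfl
      rw [h0, zero_add, if_pos hqp]
      simp only [isPQShuffle_permInsert_self q hqp, hqp, permCount]
      split_ifs with hz <;> simp [hz]
    · rw [if_neg hqp, add_zero]
      by_cases hq0 : q = 0
      · subst hq0
        obtain ⟨p, rfl⟩ : ∃ p', p = p' + 1 := ⟨p - 1, by simp at hqp; omega⟩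
        simp only [isPQShuffle_permInsert_zero, permCount, Nat.add_sub_cancel, Fin.val_zero,
          List.eraseIdx_zero]
        by_cases hz : l[0]? = some z <;> simp [hz]
      · rw [if_neg hq0]
        refine Finset.sum_eq_zero fun τ _ => if_neg fun h => ?_
        rcases eq_of_isPQShuffle_permInsert h.1 with h | h
        · exact hq0 (Fin.ext h)
        · exact hqp h
  rw [hsum, Finset.sum_congr rfl fun q _ => hq q, Finset.sum_add_distrib]
  congr 1
  · simp
  · by_cases hp : p ≤ n
    · have (q : Fin (n + 1)) : (q : ℕ) = p ↔ q = ⟨p, Nat.lt_succ_of_le hp⟩ :=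
        ⟨fun h => Fin.ext h, fun h => by rw [h]⟩
      simp [this, hp]
    · rw [if_neg (fun h => hp h.1 : ¬ (p ≤ n ∧ l[p]? = some z))]
      refine Finset.sum_eq_zero fun q _ => if_neg fun h => hp ?_
      rw [← h]
      exact Nat.lt_succ_iff.1 q.isLt

theorem permCount_append (a b w : List X) (h : w.length = a.length + b.length) :
    permCount a.length (a.length + b.length) (a ++ b) w = shufCount a b w := by
  induction w generalizing a b with
  | nil =>
    obtain ⟨rfl, rfl⟩ : a = [] ∧ b = [] := by simpa [eq_comm] using h
    simp [permCount, shufCount, IsPQShuffle]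
  | cons z w ih =>
    obtain ⟨n, hn⟩ : ∃ n, a.length + b.length = n + 1 := ⟨w.length, by simp [← h]⟩
    rw [hn, permCount_succ, shufCount]
    congr 1
    · cases a with
      | nil => simp
      | cons x a =>
        have := ih a b (by simp at h; omega)
        rw [show a.length + b.length = n by simp at hn; omega] at this
        simp [this]
    · cases b with
      | nil => simp
      | cons x b =>
        have := ih a b (by simp at h; omega)
        rw [show a.length + b.length = n by simp at hn; omega] at this
        have hle : a.length ≤ n := by simp at hn; omega
        simp [List.eraseIdx_append_of_length_le, this, hle]

theorem shMulWord_apply (k : Type*) [Field k] (a b w : List X) :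
    shMulWord k a b w = (shufCount a b w : k) := by
  rw [shMulWord, Finsupp.finsetSum_apply]
  by_cases hw : w.length = a.length + b.length
  · rw [← permCount_append a b w hw, permCount, Nat.cast_sum]
    refine Finset.sum_congr rfl fun σ _ => ?_
    have : (List.ofFn fun j : Fin (a.length + b.length) =>
        (a ++ b).get (Fin.cast (by simp) (σ.symm j))) = w ↔
        ∀ i : Fin (a.length + b.length), (a ++ b)[(i : ℕ)]? = w[(σ i : ℕ)]? := by
      constructor
      · rintro rfl i
        simp
      · intro h
        refine List.ext_getElem (by simp [hw]) fun j h₁ h₂ => ?_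
        have := h (σ.symm ⟨j, by simpa using h₁⟩)
        simp only [Equiv.apply_symm_apply] at this
        rw [List.getElem?_eq_getElem (by simp), List.getElem?_eq_getElem h₂,
          Option.some.injEq] at this
        simpa using this
    by_cases hσ : IsPQShuffle a.length σ
    · simp only [hσ, if_true, true_and, Finsupp.single_apply, this]
      push_cast
      rfl
    · simp [hσ]
  · rw [shufCount_eq_zero_of_length_ne hw, Nat.cast_zero]
    refine Finset.sum_eq_zero fun σ _ => ?_
    split_ifs
    · rw [Finsupp.single_apply, if_neg]
      rintro rfl
      simp at hw
    · rfl

end PermCount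

section Triangular

variable {k X : Type*} [Field k]

theorem shMul_single_apply (p w : List X) (g : List X →₀ k) :
    shMul (Finsupp.single p 1) g w = ∑ u ∈ g.support, g u * (shufCount p u w : k) := by
  rw [shMul, Finsupp.sum_single_index (by simp), Finsupp.sum, Finsupp.finsetSum_apply]
  simp [shMulWord_apply]

theorem XOf_cons (p : List X) (L : List (List X)) :
    XOf k (p :: L) = shMul (Finsupp.single p 1) (XOf k L) := rfl

theorem XOf_nil : XOf k ([] : List (List X)) = Finsupp.single [] 1 := rfl

theorem exists_shuf_of_shMul_single_ne_zero {p w : List X} {g : List X →₀ k}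
    (h : shMul (Finsupp.single p 1) g w ≠ 0) : ∃ u, g u ≠ 0 ∧ Shuf p u w := by
  rw [shMul_single_apply] at h
  obtain ⟨u, hu, h⟩ := Finset.exists_ne_zero_of_sum_ne_zero h
  refine ⟨u, Finsupp.mem_support_iff.1 hu, shuf_of_shufCount_ne_zero fun h0 => h ?_⟩
  simp [h0]

theorem perm_of_XOf_ne_zero {L : List (List X)} {w : List X} (h : XOf k L w ≠ 0) :
    w.Perm L.flatten := by
  induction L generalizing w with
  | nil =>
    rw [XOf_nil, Finsupp.single_apply_ne_zero] at h
    simp [h.1]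
  | cons p L ih =>
    obtain ⟨u, hu, h⟩ := exists_shuf_of_shMul_single_ne_zero (XOf_cons (k := k) p L ▸ h)
    exact h.perm.trans ((ih hu).append_left p)

theorem finite_setOf_perm (a : List X) (P : List X → Prop) :
    {w : List X | w.Perm a ∧ P w}.Finite :=
  (List.finite_toSet a.permutations).subset fun _ hw => List.mem_permutations.2 hw.1

variable [LinearOrder X]

theorem XOf_replicate {p : List X} (hp : IsLyndon p) {L : List (List X)}
    (hL : wlt p L.flatten) (hle : ∀ w, XOf k L w ≠ 0 → wle L.flatten w) (n : ℕ) :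
    (∀ w, XOf k (List.replicate n p ++ L) w ≠ 0 →
      wle ((List.replicate n p).flatten ++ L.flatten) w) ∧
    XOf k (List.replicate n p ++ L) ((List.replicate n p).flatten ++ L.flatten) =
      (n.factorial : k) * XOf k L L.flatten := by
  induction n with
  | zero => simpa using hle
  | succ n ih =>
    simp only [List.replicate_succ, List.cons_append, List.flatten_cons, List.append_assoc,
      XOf_cons]
    set t := (List.replicate n p).flatten ++ L.flatten with ht
    set g := XOf k (List.replicate n p ++ L) with hg
    have hlt {u w : List X} (hu : g u ≠ 0) (hut : u ≠ t) (h : Shuf p u w) : wlt (p ++ t) w := by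
      have hlen : t.length = u.length := by
        rw [(perm_of_XOf_ne_zero (k := k) hu).length_eq, ht, List.flatten_append]
      rcases ih.1 u hu with h' | h'
      · exact absurd h'.symm hut
      · obtain ⟨w', h₁, h₂⟩ := h.exists_wlt h' hlen
        exact (hp.wle_shuf_replicate hL n h₁).trans_wlt h₂
    constructor
    · intro w hw
      obtain ⟨u, hu, h⟩ := exists_shuf_of_shMul_single_ne_zero hw
      by_cases hut : u = t
      · rw [hut] at h
        exact hp.wle_shuf_replicate hL n h
      · exact wle_of_wlt (hlt hu hut h)
    · rw [shMul_single_apply, Finset.sum_eq_single t]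
      · rw [hp.shufCount_replicate hL n, ih.2, Nat.factorial_succ]
        push_cast
        ring
      · intro u hu hut
        rw [Finsupp.mem_support_iff] at hu
        have : shufCount p u (p ++ t) = 0 := by
          by_contra h
          exact wlt_irrefl _ (hlt hu hut (shuf_of_shufCount_ne_zero h))
        simp [this]
      · intro h
        simp [Finsupp.notMem_support_iff.1 h]

/-- The iterated shuffle product attached to a monotone list of Lyndon powers involves only words
that are at least the concatenation, whose coefficient is the product of the factorials. -/
theorem XOf_lyndon_powers (L : List (List X × ℕ)) (hly : ∀ pn ∈ L, IsLyndon pn.1)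
    (hsorted : (L.map Prod.fst).Pairwise wlt) :
    (∀ w, XOf k (L.flatMap fun pn => List.replicate pn.2 pn.1) w ≠ 0 →
      wle (L.flatMap fun pn => List.replicate pn.2 pn.1).flatten w) ∧
    XOf k (L.flatMap fun pn => List.replicate pn.2 pn.1)
      (L.flatMap fun pn => List.replicate pn.2 pn.1).flatten =
        ((L.map fun pn => Nat.factorial pn.2).prod : ℕ) := by
  induction L with
  | nil =>
    refine ⟨fun w h => ?_, by simp [XOf_nil]⟩
    rw [List.flatMap_nil, XOf_nil, Finsupp.single_apply_ne_zero] at h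
    exact .inl (by simp [h.1])
  | cons pn L ih =>
    obtain ⟨p, n⟩ := pn
    rw [List.map_cons, List.pairwise_cons] at hsorted
    obtain ⟨ih₁, ih₂⟩ := ih (fun pn h => hly pn (by simp [h])) hsorted.2
    have hp : IsLyndon p := hly (p, n) (by simp)
    have hlt : wlt p (L.flatMap fun pn => List.replicate pn.2 pn.1).flatten := by
      refine hp.wlt_flatten _ fun q hq => ?_
      obtain ⟨pn, hpn, hq⟩ := List.mem_flatMap.1 hq
      rw [(List.mem_replicate.1 hq).2]
      exact hsorted.1 _ (List.mem_map_of_mem hpn)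
    have := XOf_replicate (k := k) hp hlt ih₁ n
    rw [List.flatMap_cons, List.flatten_append]
    refine ⟨this.1, this.2.trans ?_⟩
    rw [ih₂]
    simp

/-- Induction on words, from large to small within a class of rearrangements. -/
theorem wlt_perm_induction {P : List X → Prop}
    (h : ∀ a, (∀ w, w.Perm a → wlt a w → P w) → P a) (a : List X) : P a := by
  obtain ⟨n, hn⟩ : ∃ n, {w : List X | w.Perm a ∧ wlt a w}.ncard = n := ⟨_, rfl⟩
  induction n using Nat.strong_induction_on generalizing a with
  | _ n ih =>
    refine h a fun w hw hlt => ih _ ?_ w rfl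
    rw [← hn]
    refine Set.ncard_lt_ncard (Set.ssubset_iff_of_subset ?_ |>.2 ⟨w, ⟨hw, hlt⟩, ?_⟩)
      (finite_setOf_perm a _)
    · exact fun v hv => ⟨hv.1.trans hw, wlt_trans hlt hv.2⟩
    · exact fun hv => wlt_irrefl w hv.2

/-- Induction on words, from small to large within a class of rearrangements. -/
theorem wlt_perm_induction' {P : List X → Prop}
    (h : ∀ a, (∀ w, w.Perm a → wlt w a → P w) → P a) (a : List X) : P a := by
  obtain ⟨n, hn⟩ : ∃ n, {w : List X | w.Perm a ∧ wlt w a}.ncard = n := ⟨_, rfl⟩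
  induction n using Nat.strong_induction_on generalizing a with
  | _ n ih =>
    refine h a fun w hw hlt => ih _ ?_ w rfl
    rw [← hn]
    refine Set.ncard_lt_ncard (Set.ssubset_iff_of_subset ?_ |>.2 ⟨w, ⟨hw, hlt⟩, ?_⟩)
      (finite_setOf_perm a _)
    · exact fun v hv => ⟨hv.1.trans hw, wlt_trans hv.2 hlt⟩
    · exact fun hv => wlt_irrefl w hv.2

variable {Y : List X → List X →₀ k}

theorem linearIndependent_of_triangular (hdiag : ∀ a, Y a a ≠ 0)
    (hperm : ∀ a w, Y a w ≠ 0 → w.Perm a) (hle : ∀ a w, Y a w ≠ 0 → wle a w) :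
    LinearIndependent k Y := by
  rw [linearIndependent_iff]
  intro l hl
  ext a
  induction a using wlt_perm_induction' with
  | h a ih =>
    have h := DFunLike.congr_fun hl a
    rw [Finsupp.linearCombination_apply, Finsupp.sum, Finsupp.finsetSum_apply,
      Finset.sum_eq_single a] at h
    · simpa [hdiag a] using h
    · intro b _ hba
      by_contra hne
      have hYne : Y b a ≠ 0 := fun h0 => hne (by simp [h0])
      rcases hle b a hYne with h' | h'
      · exact hba h'
      · exact hne (by simp [ih b (hperm b a hYne).symm h'])
    · intro h'
      simp [Finsupp.notMem_support_iff.1 h']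

theorem span_eq_of_triangular (hdiag : ∀ a, Y a a ≠ 0)
    (hperm : ∀ a w, Y a w ≠ 0 → w.Perm a) (hle : ∀ a w, Y a w ≠ 0 → wle a w) :
    Submodule.span k (Set.range fun a : {a : List X // a ≠ []} => Y a.1) =
      Submodule.span k (Set.range fun b : {b : List X // b ≠ []} =>
        Finsupp.single b.1 (1 : k)) := by
  apply le_antisymm
  · rw [Submodule.span_le]
    rintro _ ⟨⟨a, ha⟩, rfl⟩
    rw [SetLike.mem_coe]
    dsimp only
    rw [← Finsupp.sum_single (Y a), Finsupp.sum]
    refine Submodule.sum_mem _ fun w hw => ?_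
    rw [← Finsupp.smul_single_one]
    refine Submodule.smul_mem _ _ (Submodule.subset_span ⟨⟨w, ?_⟩, rfl⟩)
    rintro rfl
    exact ha (hperm a [] (Finsupp.mem_support_iff.1 hw)).symm.eq_nil
  · rw [Submodule.span_le]
    rintro _ ⟨⟨a, ha⟩, rfl⟩
    induction a using wlt_perm_induction with
    | h a ih =>
      have hsum : Y a a • Finsupp.single a (1 : k) =
          Y a - ∑ w ∈ (Y a).support.erase a, Y a w • Finsupp.single w (1 : k) := by
        rw [eq_sub_iff_add_eq, Finset.add_sum_erase _ (fun w => Y a w • Finsupp.single w (1 : k))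
          (Finsupp.mem_support_iff.2 (hdiag a))]
        simp only [Finsupp.smul_single_one]
        exact Finsupp.sum_single (Y a)
      refine (Submodule.smul_mem_iff _ (hdiag a)).1 ?_
      dsimp only
      rw [hsum]
      refine Submodule.sub_mem _ (Submodule.subset_span ⟨⟨a, ha⟩, rfl⟩)
        (Submodule.sum_mem _ fun w hw => Submodule.smul_mem _ _ ?_)
      obtain ⟨hwa, hw⟩ := Finset.mem_erase.1 hw
      rw [Finsupp.mem_support_iff] at hw
      have hp := hperm a w hw
      refine ih w hp ((hle a w hw).resolve_left (Ne.symm hwa)) ?_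
      rintro rfl
      exact ha hp.symm.eq_nil

end Triangular

/-- In the classical shuffle algebra over a field of characteristic zero, with
`X_a = v_{p₁}^{·n₁} ⋯ v_{p_s}^{·n_s}` for the Lyndon factorization
`a = p₁^{n₁}⋯p_s^{n_s}` (encoded by `F a`, `p₁ < ⋯ < p_s`), the leading
coefficient of `v_a` in `X_a` is `n₁!⋯n_s! ≠ 0`; consequently the `X_a`,
`a ∈ S` (i.e. `a` nonempty), form a linear basis of `⊕_{n ≥ 1} V^{⊗n}`. -/
theorem classical_shuffle_lyndon_basis {k X : Type*} [Field k] [CharZero k]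
    [LinearOrder X]
    (F : List X → List (List X × ℕ))
    (hjoin : ∀ a : List X,
      (((F a).flatMap fun pn => List.replicate pn.2 pn.1)).flatten = a)
    (hly : ∀ a : List X, ∀ pn ∈ F a, IsLyndon pn.1)
    (hpos : ∀ a : List X, ∀ pn ∈ F a, 0 < pn.2)
    (hsorted : ∀ a : List X, ((F a).map Prod.fst).Chain' wlt) :
    (∀ a : List X,
      (XOf k ((F a).flatMap fun pn => List.replicate pn.2 pn.1)) a =
        (((F a).map fun pn => Nat.factorial pn.2).prod : ℕ) ∧
      ((((F a).map fun pn => Nat.factorial pn.2).prod : ℕ) : k) ≠ 0) ∧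
    LinearIndependent k (fun a : {a : List X // a ≠ []} =>
      XOf k ((F a.1).flatMap fun pn => List.replicate pn.2 pn.1)) ∧
    Submodule.span k (Set.range fun a : {a : List X // a ≠ []} =>
        XOf k ((F a.1).flatMap fun pn => List.replicate pn.2 pn.1)) =
      Submodule.span k (Set.range fun b : {b : List X // b ≠ []} =>
        Finsupp.single b.1 (1 : k)) := by
  have htri (a : List X) := XOf_lyndon_powers (k := k) (F a) (hly a)
    ((@List.isChain_iff_pairwise _ wlt _ ⟨wlt_trans⟩).1 (hsorted a))
  simp only [hjoin] at htri
  have hfac (a : List X) : ((((F a).map fun pn => Nat.factorial pn.2).prod : ℕ) : k) ≠ 0 := by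
    rw [Nat.cast_ne_zero]
    refine List.prod_ne_zero fun h => ?_
    obtain ⟨pn, -, h⟩ := List.mem_map.1 h
    exact Nat.factorial_ne_zero _ h
  let Y (a : List X) : List X →₀ k := XOf k ((F a).flatMap fun pn => List.replicate pn.2 pn.1)
  have hdiag (a : List X) : Y a a ≠ 0 := (htri a).2 ▸ hfac a
  have hperm (a w : List X) (h : Y a w ≠ 0) : w.Perm a :=
    (perm_of_XOf_ne_zero h).trans (List.Perm.of_eq (hjoin a))
  have hle (a w : List X) (h : Y a w ≠ 0) : wle a w := (htri a).1 w h
  exact ⟨fun a => ⟨(htri a).2, hfac a⟩,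
    (linearIndependent_of_triangular (Y := Y) hdiag hperm hle).comp Subtype.val
      Subtype.val_injective,
    span_eq_of_triangular (Y := Y) hdiag hperm hle⟩
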